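/- Let X be a shift with property (A) whose syntactic semigroup is S(X). Then S(X) is aperiodic: every maximal subgroup (H-class containing an idempotent) of S(X) is trivial. -/

import Mathlib

/-- The language of finite blocks of a subset `Y ⊆ A^ℤ`. -/
def langOf {A : Type*} (Y : Set (ℤ → A)) : Set (List A) :=
  {u | u ≠ [] ∧ ∃ z ∈ Y, ∃ i : ℤ, u = (List.range u.length).map fun k => z (i + (k : ℤ))}

/-- The two-sided context of a word `u` in the language of `X`. -/
def ctxOf {A : Type*} (X : Set (ℤ → A)) (u : List A) : Set (List A × List A) :=
  {pq | pq.1 ++ u ++ pq.2 ∈ langOf X}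

/-- The word `x_{[i, i+n-1]}` read in the bi-infinite sequence `x`. -/
def wordAt {A : Type*} (x : ℤ → A) (i : ℤ) (n : ℕ) : List A :=
  (List.range n).map fun k => x (i + (k : ℤ))

/-- `v ∈ ω⁺(u)`: `v` is in the language and `wu ∈ L ⟹ wuv ∈ L` for all `w`. -/
def omegaPlus {A : Type*} (L : Set (List A)) (u v : List A) : Prop :=
  v ∈ L ∧ ∀ w : List A, w ++ u ∈ L → w ++ u ++ v ∈ L

/-- `v ∈ ω⁻(u)`: `v` is in the language and `uw ∈ L ⟹ vuw ∈ L` for all `w`. -/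
def omegaMinus {A : Type*} (L : Set (List A)) (u v : List A) : Prop :=
  v ∈ L ∧ ∀ w : List A, u ++ w ∈ L → v ++ (u ++ w) ∈ L

/-- The approximating `n`-step subshift `A_n(X) = A_n⁺(X) ∩ A_n⁻(X)`. -/
def An {A : Type*} (X : Set (ℤ → A)) (n : ℕ) : Set (ℤ → A) :=
  {x | x ∈ X ∧ ∀ i : ℤ,
    omegaPlus (langOf X) (wordAt x (i - (n : ℤ)) n) [x i] ∧
    omegaMinus (langOf X) (wordAt x (i + 1) n) [x i]}

/-- Krieger's property (𝒜): for every `n ≥ 1` there is `H` such that any two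
words `puq, pvq ∈ L(A_n(X))` with `|p| = |q| = H` have the same context in `X`. -/
def PropertyA {A : Type*} (X : Set (ℤ → A)) : Prop :=
  ∀ n : ℕ, 1 ≤ n → ∃ H : ℕ, ∀ p u v q : List A,
    p.length = H → q.length = H →
    p ++ u ++ q ∈ langOf (An X n) → p ++ v ++ q ∈ langOf (An X n) →
    ctxOf X (p ++ u ++ q) = ctxOf X (p ++ v ++ q)

/-- Green's `R` relation on the syntactic semigroup `S(X)`, on word representatives. -/
def GreenRw {A : Type*} (X : Set (ℤ → A)) (u v : List A) : Prop :=
  (ctxOf X u = ctxOf X v ∨ ∃ w : List A, w ≠ [] ∧ ctxOf X (u ++ w) = ctxOf X v) ∧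
  (ctxOf X v = ctxOf X u ∨ ∃ w : List A, w ≠ [] ∧ ctxOf X (v ++ w) = ctxOf X u)

/-- Green's `L` relation on the syntactic semigroup `S(X)`, on word representatives. -/
def GreenLw {A : Type*} (X : Set (ℤ → A)) (u v : List A) : Prop :=
  (ctxOf X u = ctxOf X v ∨ ∃ w : List A, w ≠ [] ∧ ctxOf X (w ++ u) = ctxOf X v) ∧
  (ctxOf X v = ctxOf X u ∨ ∃ w : List A, w ≠ [] ∧ ctxOf X (w ++ v) = ctxOf X u)

theorem wordAt_def {A : Type*} (x : ℤ → A) (i : ℤ) (n : ℕ) :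
    wordAt x i n = (List.range n).map (fun k : ℕ => x (i + (k : ℤ))) := by
  have e : (do let a ← List.range n; pure (a : ℤ) : List ℤ)
      = (List.range n).map (fun k : ℕ => (k : ℤ)) := by
    simp only [List.bind_eq_flatMap, List.pure_def]
    induction List.range n with
    | nil => rfl
    | cons a l ih => simpa using ih
  unfold wordAt
  rw [e, List.map_map]
  rfl

theorem wordAt_length' {A : Type*} (x : ℤ → A) (i : ℤ) (n : ℕ) : (wordAt x i n).length = n := by
  simp [wordAt]

theorem wordAt_add {A : Type*} (x : ℤ → A) (i : ℤ) (m k : ℕ) :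
    wordAt x i (m + k) = wordAt x i m ++ wordAt x (i + m) k := by
  simp only [wordAt_def, List.range_add, List.map_append, List.map_map]
  congr 1
  apply List.map_congr_left
  intro a _
  simp [add_assoc]

theorem wordAt_one {A : Type*} (x : ℤ → A) (i : ℤ) : wordAt x i 1 = [x i] := by
  simp [wordAt, List.range_succ]

theorem mem_langOf {A : Type*} (Y : Set (ℤ → A)) (u : List A) :
    u ∈ langOf Y ↔ u ≠ [] ∧ ∃ z ∈ Y, ∃ i : ℤ, u = wordAt z i u.length := Iff.rfl

theorem wordAt_mem {A : Type*} {Y : Set (ℤ → A)} {z : ℤ → A} (hz : z ∈ Y) (i : ℤ) (n : ℕ)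
    (hn : n ≠ 0) : wordAt z i n ∈ langOf Y := by
  refine (mem_langOf _ _).2 ⟨?_, z, hz, i, by rw [wordAt_length']⟩
  intro h
  have := wordAt_length' z i n
  rw [h] at this
  exact hn this.symm

theorem lang_factor {A : Type*} {Y : Set (ℤ → A)} {p a q : List A}
    (h : p ++ a ++ q ∈ langOf Y) (ha : a ≠ []) : a ∈ langOf Y := by
  obtain ⟨_, z, hz, i, hi⟩ := (mem_langOf _ _).1 h
  rw [List.length_append, List.length_append, wordAt_add, wordAt_add] at hi
  have h1 := (List.append_inj hi (by simp [wordAt_length'])).1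
  have h2 := (List.append_inj h1 (by simp [wordAt_length'])).2
  exact (mem_langOf _ _).2 ⟨ha, z, hz, _, h2⟩

theorem ctx_congr {A : Type*} {X : Set (ℤ → A)} {a b : List A} (s t : List A)
    (h : ctxOf X a = ctxOf X b) : ctxOf X (s ++ a ++ t) = ctxOf X (s ++ b ++ t) := by
  ext ⟨p, q⟩
  have := Set.ext_iff.1 h (p ++ s, t ++ q)
  simpa [ctxOf] using this

theorem ctx_left {A : Type*} {X : Set (ℤ → A)} {a b : List A} (s : List A)
    (h : ctxOf X a = ctxOf X b) : ctxOf X (s ++ a) = ctxOf X (s ++ b) := by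
  simpa using ctx_congr s [] h

theorem ctx_right {A : Type*} {X : Set (ℤ → A)} {a b : List A} (t : List A)
    (h : ctxOf X a = ctxOf X b) : ctxOf X (a ++ t) = ctxOf X (b ++ t) := by
  simpa using ctx_congr [] t h

theorem shift_all {A : Type*} {X : Set (ℤ → A)}
    (hshift : ∀ z : ℤ → A, z ∈ X ↔ (fun i => z (i + 1)) ∈ X) (z : ℤ → A) (hz : z ∈ X) (m : ℤ) :
    (fun i => z (i + m)) ∈ X := by
  induction m using Int.induction_on with
  | zero => simpa using hz
  | succ k ih =>
    have := (hshift _).1 ih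
    convert this using 2 with i
    ring_nf
  | pred k ih =>
    refine (hshift _).2 ?_
    convert ih using 2 with i
    ring_nf

/-- the power of a word -/
def wpow {A : Type*} (u : List A) : ℕ → List A
  | 0 => []
  | n + 1 => u ++ wpow u n

theorem wpow_succ' {A : Type*} (u : List A) (n : ℕ) : wpow u (n + 1) = wpow u n ++ u := by
  induction n with
  | zero => simp [wpow]
  | succ k ih =>
    have e : wpow u (k + 1) = u ++ wpow u k := rfl
    rw [wpow, ih, ← List.append_assoc, ← e, ih]

theorem wpow_length {A : Type*} (u : List A) (n : ℕ) : (wpow u n).length = n * u.length := by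
  induction n with
  | zero => simp [wpow]
  | succ k ih => rw [wpow, List.length_append, ih]; ring

theorem ctx_wpow_left {A : Type*} {X : Set (ℤ → A)} {u v : List A}
    (h : ctxOf X (u ++ v) = ctxOf X v) (n : ℕ) : ctxOf X (wpow u n ++ v) = ctxOf X v := by
  induction n with
  | zero => simp [wpow]
  | succ k ih => rw [wpow, List.append_assoc, ctx_left u ih, h]

theorem ctx_wpow_right {A : Type*} {X : Set (ℤ → A)} {u v : List A}
    (h : ctxOf X (v ++ u) = ctxOf X v) (n : ℕ) : ctxOf X (v ++ wpow u n) = ctxOf X v := by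
  induction n with
  | zero => simp [wpow]
  | succ k ih => rw [wpow_succ', ← List.append_assoc, ctx_right u ih, h]

/-- the sequence `⋯uu.vuu⋯` -/
def seqOf {A : Type*} (a : A) (u v : List A) (i : ℤ) : A :=
  if i < 0 then u.getD (i % u.length).toNat a
  else if i < v.length then v.getD i.toNat a
  else u.getD ((i - v.length) % u.length).toNat a

theorem wordAt_eq {A : Type*} (a : A) (x : ℤ → A) (j : ℤ) (c : List A)
    (h : ∀ k : ℕ, k < c.length → x (j + k) = c.getD k a) : wordAt x j c.length = c := by
  apply List.ext_getElem
  · simp [wordAt]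
  · intro k h1 h2
    have := h k h2
    rw [List.getD_eq_getElem _ _ h2] at this
    simpa [wordAt_def] using this

theorem seqOf_neg {A : Type*} (a : A) (u v : List A) (m : ℤ) (hm : m < 0) :
    wordAt (seqOf a u v) (u.length * m) u.length = u := by
  apply wordAt_eq a
  intro k hk
  have h1 : (u.length * m + k : ℤ) < 0 := by nlinarith
  have h2 : (u.length * m + k : ℤ) % u.length = k := by
    rw [Int.mul_add_emod_self_left]
    exact Int.emod_eq_of_lt (by omega) (by omega)
  simp [seqOf, h1, h2]

theorem seqOf_zero {A : Type*} (a : A) (u v : List A) :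
    wordAt (seqOf a u v) 0 v.length = v := by
  apply wordAt_eq a
  intro k hk
  have h1 : ¬ ((0 : ℤ) + k < 0) := by omega
  have h2 : (0 : ℤ) + k < v.length := by omega
  rw [seqOf, if_neg h1, if_pos h2]
  simp

theorem seqOf_pos {A : Type*} (a : A) (u v : List A) (m : ℤ) (hm : 0 ≤ m) :
    wordAt (seqOf a u v) (v.length + u.length * m) u.length = u := by
  apply wordAt_eq a
  intro k hk
  have h0 : (0 : ℤ) ≤ u.length * m := by positivity
  have h1 : ¬ ((v.length + u.length * m + k : ℤ) < 0) := by omega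
  have h3 : ¬ ((v.length + u.length * m + k : ℤ) < v.length) := by omega
  have h2 : (v.length + u.length * m + k - v.length : ℤ) % u.length = k := by
    rw [show (v.length + u.length * m + k - v.length : ℤ) = u.length * m + k by ring,
      Int.mul_add_emod_self_left]
    exact Int.emod_eq_of_lt (by omega) (by omega)
  rw [seqOf, if_neg h1, if_neg h3, h2]
  simp

theorem seqOf_left {A : Type*} (a : A) (u v : List A) (N : ℕ) :
    wordAt (seqOf a u v) (-(N * u.length)) (N * u.length) = wpow u N := by
  induction N with
  | zero => simp [wordAt, wpow]
  | succ k ih =>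
    rw [show (k + 1) * u.length = u.length + k * u.length by ring, wordAt_add, wpow]
    congr 1
    · have := seqOf_neg a u v (-(k + 1)) (by omega)
      rw [show (-(((k + 1 : ℕ) : ℤ) * u.length) : ℤ) = u.length * (-(k + 1)) by push_cast; ring]
      exact this
    · rw [← ih]
      congr 1
      push_cast; ring

theorem seqOf_right {A : Type*} (a : A) (u v : List A) (N : ℕ) :
    wordAt (seqOf a u v) v.length (N * u.length) = wpow u N := by
  induction N with
  | zero => simp [wordAt, wpow]
  | succ k ih =>
    rw [show (k + 1) * u.length = k * u.length + u.length by ring, wordAt_add, wpow_succ', ih]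
    congr 1
    have := seqOf_pos a u v k (by omega)
    rw [show ((v.length : ℤ) + ((k * u.length : ℕ) : ℤ)) = v.length + u.length * k by
      push_cast; ring]
    exact this

theorem seqOf_mid {A : Type*} (a : A) (u v : List A) (N : ℕ) :
    wordAt (seqOf a u v) (-(N * u.length)) (N * u.length + v.length + N * u.length)
      = wpow u N ++ v ++ wpow u N := by
  rw [wordAt_add, wordAt_add, seqOf_left]
  congr 1
  · congr 1
    convert seqOf_zero a u v using 2
    push_cast; ring
  · convert seqOf_right a u v N using 2
    push_cast; ring

theorem seqOf_blocks {A : Type*} (a : A) (u v : List A) (hu : u ≠ []) (i : ℤ) :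
    ∃ b c d : List A, ∃ j : ℤ, (b = u ∨ b = v) ∧ (c = u ∨ c = v) ∧ (d = u ∨ d = v) ∧
      j ≤ i ∧ i < j + c.length ∧ wordAt (seqOf a u v) (j - b.length) b.length = b ∧
      wordAt (seqOf a u v) j c.length = c ∧
      wordAt (seqOf a u v) (j + c.length) d.length = d := by
  have hl : (0 : ℤ) < u.length := by
    have := List.length_pos_iff.2 hu
    omega
  by_cases h0 : i < 0
  · have e := Int.mul_ediv_add_emod i u.length
    have e1 := Int.emod_nonneg i hl.ne'
    have e2 := Int.emod_lt_of_pos i hl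
    have hm : i / (u.length : ℤ) < 0 := Int.ediv_neg_of_neg_of_pos h0 hl
    generalize hmm : i / (u.length : ℤ) = m at *
    have hb : wordAt (seqOf a u v) (u.length * m - u.length) u.length = u := by
      rw [show (u.length * m - u.length : ℤ) = u.length * (m - 1) by ring]
      exact seqOf_neg a u v _ (by omega)
    rcases eq_or_ne m (-1) with h | h
    · refine ⟨u, u, v, u.length * m, .inl rfl, .inl rfl, .inr rfl, by omega, by omega, hb,
        seqOf_neg a u v m hm, ?_⟩
      rw [show (u.length * m + u.length : ℤ) = 0 by rw [h]; ring]
      exact seqOf_zero a u v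
    · refine ⟨u, u, u, u.length * m, .inl rfl, .inl rfl, .inl rfl, by omega, by omega, hb,
        seqOf_neg a u v m hm, ?_⟩
      rw [show (u.length * m + u.length : ℤ) = u.length * (m + 1) by ring]
      exact seqOf_neg a u v _ (by omega)
  · by_cases h1 : i < v.length
    · refine ⟨u, v, u, 0, .inl rfl, .inr rfl, .inl rfl, by omega, by omega, ?_,
        seqOf_zero a u v, ?_⟩
      · have := seqOf_neg a u v (-1) (by omega)
        rw [show (0 - u.length : ℤ) = u.length * (-1) by ring]
        exact this
      · have := seqOf_pos a u v 0 le_rfl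
        rw [show (0 + v.length : ℤ) = v.length + u.length * 0 by ring]
        exact this
    · have e := Int.mul_ediv_add_emod (i - v.length) u.length
      have e1 := Int.emod_nonneg (i - v.length) hl.ne'
      have e2 := Int.emod_lt_of_pos (i - v.length) hl
      have hm : 0 ≤ (i - v.length) / (u.length : ℤ) := Int.ediv_nonneg (by omega) hl.le
      generalize hmm : (i - v.length) / (u.length : ℤ) = m at *
      have hd : wordAt (seqOf a u v) (v.length + u.length * m + u.length) u.length = u := by
        rw [show (v.length + u.length * m + u.length : ℤ) = v.length + u.length * (m + 1) by ring]
        exact seqOf_pos a u v _ (by omega)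
      rcases eq_or_ne m 0 with h | h
      · refine ⟨v, u, u, v.length + u.length * m, .inr rfl, .inl rfl, .inl rfl, by omega, by omega,
          ?_, seqOf_pos a u v m hm, hd⟩
        rw [show (v.length + u.length * m - v.length : ℤ) = 0 by rw [h]; ring]
        exact seqOf_zero a u v
      · refine ⟨u, u, u, v.length + u.length * m, .inl rfl, .inl rfl, .inl rfl, by omega, by omega,
          ?_, seqOf_pos a u v m hm, hd⟩
        rw [show (v.length + u.length * m - u.length : ℤ) = v.length + u.length * (m - 1) by ring]
        exact seqOf_pos a u v _ (by omega)

theorem seqOf_mem {A : Type*} (X : Set (ℤ → A))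
    (hshift : ∀ z : ℤ → A, z ∈ X ↔ (fun i => z (i + 1)) ∈ X)
    (hclosed : ∀ z : ℤ → A,
      (∀ n : ℕ, ∃ z' ∈ X, ∀ i : ℤ, |i| ≤ (n : ℤ) → z' i = z i) → z ∈ X)
    (a : A) (u v : List A) (hu : u ≠ []) (hv : v ∈ langOf X)
    (huv : ctxOf X (u ++ v) = ctxOf X v) (hvu : ctxOf X (v ++ u) = ctxOf X v) :
    seqOf a u v ∈ X := by
  apply hclosed
  intro n
  have hl := List.length_pos_iff.2 hu
  set N := n + 1 with hN
  have hc : ctxOf X (wpow u N ++ v ++ wpow u N) = ctxOf X v := by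
    rw [ctx_right _ (ctx_wpow_left huv N), ctx_wpow_right hvu]
  have hm : wpow u N ++ v ++ wpow u N ∈ langOf X := by
    have : (([] : List A), ([] : List A)) ∈ ctxOf X v := by simpa [ctxOf] using hv
    rw [← hc] at this
    simpa [ctxOf] using this
  obtain ⟨_, z, hz, i, hi⟩ := (mem_langOf _ _).1 hm
  rw [← seqOf_mid a, wordAt_length'] at hi
  refine ⟨_, shift_all hshift z hz (i + N * u.length), ?_⟩
  intro k hk
  have hk' := abs_le.1 hk
  have hNl : (N : ℤ) ≤ N * u.length := by
    have : (1 : ℤ) ≤ u.length := by omega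
    nlinarith
  have hv0 : 0 ≤ v.length := by omega
  obtain ⟨t, ht⟩ : ∃ t : ℕ, (t : ℤ) = k + N * u.length := ⟨(k + N * u.length).toNat, by omega⟩
  have htl : t < N * u.length + v.length + N * u.length := by
    zify
    omega
  have := congrArg (fun l : List A => l[t]?) hi
  simp only [wordAt_def, List.getElem?_map, List.getElem?_range htl, Option.map_some,
    Option.some.injEq] at this
  rw [ht] at this
  rw [show (-(N * u.length) + (k + N * u.length) : ℤ) = k by ring] at this
  rw [this]
  congr 1
  ring

theorem seqOf_An {A : Type*} (X : Set (ℤ → A))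
    (hshift : ∀ z : ℤ → A, z ∈ X ↔ (fun i => z (i + 1)) ∈ X)
    (hclosed : ∀ z : ℤ → A,
      (∀ n : ℕ, ∃ z' ∈ X, ∀ i : ℤ, |i| ≤ (n : ℤ) → z' i = z i) → z ∈ X)
    (a : A) (u v : List A) (hu : u ≠ []) (hv : v ∈ langOf X) (n : ℕ)
    (hn : 2 * u.length + 2 * v.length ≤ n)
    (huv : ctxOf X (u ++ v) = ctxOf X v) (hvu : ctxOf X (v ++ u) = ctxOf X v)
    (hR : ∀ b c : List A, (b = u ∨ b = v) → (c = u ∨ c = v) →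
      ∃ t, ctxOf X (b ++ c ++ t) = ctxOf X b)
    (hL : ∀ b c : List A, (b = u ∨ b = v) → (c = u ∨ c = v) →
      ∃ t, ctxOf X (t ++ c ++ b) = ctxOf X b) :
    seqOf a u v ∈ An X n := by
  have hx := seqOf_mem X hshift hclosed a u v hu hv huv hvu
  refine ⟨hx, fun i => ?_⟩
  have h1 : [seqOf a u v i] ∈ langOf X := by
    rw [← wordAt_one]; exact wordAt_mem hx i 1 one_ne_zero
  obtain ⟨b, c, d, j, hb, hc, hd, hj1, hj2, wb, wc, wd⟩ := seqOf_blocks a u v hu i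
  have lb : b.length ≤ u.length + v.length := by rcases hb with rfl | rfl <;> omega
  have lc : c.length ≤ u.length + v.length := by rcases hc with rfl | rfl <;> omega
  have ld : d.length ≤ u.length + v.length := by rcases hd with rfl | rfl <;> omega
  have hv' : v ≠ [] := hv.1
  have nb : b ≠ [] := by rcases hb with rfl | rfl <;> assumption
  have nd : d ≠ [] := by rcases hd with rfl | rfl <;> assumption
  generalize seqOf a u v = x at *
  obtain ⟨r, hr⟩ : ∃ r : ℕ, (r : ℤ) = i - j := ⟨(i - j).toNat, by omega⟩
  obtain ⟨r', hr'⟩ : ∃ r' : ℕ, (r' : ℤ) = j + c.length - (i + 1) :=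
    ⟨(j + c.length - (i + 1)).toNat, by omega⟩
  have hcs : c = wordAt x j r ++ [x i] ++ wordAt x (i + 1) r' := by
    conv_lhs => rw [← wc]
    rw [show c.length = r + 1 + r' by omega, wordAt_add, wordAt_add]
    rw [show j + (r : ℤ) = i by omega, wordAt_one,
      show j + ((r + 1 : ℕ) : ℤ) = i + 1 by push_cast; omega]
  constructor
  · refine ⟨h1, fun w hw => ?_⟩
    obtain ⟨s, hs⟩ : ∃ s : ℕ, n = s + b.length + r := ⟨n - b.length - r, by omega⟩
    have hW : wordAt x (i - n) n = wordAt x (i - n) s ++ b ++ wordAt x j r := by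
      conv_lhs => rw [hs]
      rw [wordAt_add, wordAt_add, ← hs]
      rw [show i - (n : ℤ) + s = j - b.length by omega, wb,
        show i - (n : ℤ) + ((s + b.length : ℕ) : ℤ) = j by push_cast; omega]
    rw [hW] at hw ⊢
    generalize wordAt x (i - n) s = S at *
    have h2 : w ++ S ++ b ∈ langOf X :=
      lang_factor (p := []) (q := wordAt x j r) (by simpa using hw) (by simp [nb])
    obtain ⟨t, ht⟩ := hR b c hb hc
    have h3 : (w ++ S, ([] : List A)) ∈ ctxOf X b := by simpa [ctxOf] using h2
    rw [← ht, hcs] at h3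
    refine lang_factor (p := []) (q := wordAt x (i + 1) r' ++ t) ?_ (by simp)
    simpa [ctxOf] using h3
  · refine ⟨h1, fun w hw => ?_⟩
    obtain ⟨s, hs⟩ : ∃ s : ℕ, n = r' + d.length + s := ⟨n - d.length - r', by omega⟩
    have hW : ∃ S, wordAt x (i + 1) n = wordAt x (i + 1) r' ++ d ++ S := by
      rw [hs, wordAt_add, wordAt_add]
      rw [show i + 1 + (r' : ℤ) = j + c.length by omega, wd]
      exact ⟨_, rfl⟩
    obtain ⟨S, hW⟩ := hW
    rw [hW] at hw ⊢
    have h2 : d ++ S ++ w ∈ langOf X :=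
      lang_factor (p := wordAt x (i + 1) r') (q := []) (by simpa using hw) (by simp [nd])
    obtain ⟨t, ht⟩ := hL d c hd hc
    have h3 : (([] : List A), S ++ w) ∈ ctxOf X d := by simpa [ctxOf] using h2
    rw [← ht, hcs] at h3
    refine lang_factor (p := t ++ wordAt x j r) (q := []) ?_ (by simp)
    simpa [ctxOf] using h3

/-- If a shift `X` has property (𝒜), then its syntactic semigroup is aperiodic:
every maximal subgroup is trivial, i.e. the `H`-class of each idempotent `[u]`
is reduced to `[u]` itself. -/
theorem stmt19 {A : Type*} [Fintype A] (X : Set (ℤ → A)) (hne : X.Nonempty)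
    (hshift : ∀ z : ℤ → A, z ∈ X ↔ (fun i => z (i + 1)) ∈ X)
    (hclosed : ∀ z : ℤ → A,
      (∀ n : ℕ, ∃ z' ∈ X, ∀ i : ℤ, |i| ≤ (n : ℤ) → z' i = z i) → z ∈ X)
    (hA : PropertyA X) :
    ∀ u v : List A, u ≠ [] → v ≠ [] →
      ctxOf X (u ++ u) = ctxOf X u →
      GreenRw X u v → GreenLw X u v → ctxOf X u = ctxOf X v := by
  intro u v hu hv hidem hR hL
  have huv : ctxOf X (u ++ v) = ctxOf X v := by
    rcases hR.1 with h | ⟨w, -, h⟩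
    · rw [ctx_left u h.symm, hidem, h]
    · rw [ctx_left u h.symm, ← List.append_assoc, ctx_right w hidem, h]
  have hvu : ctxOf X (v ++ u) = ctxOf X v := by
    rcases hL.1 with h | ⟨w, -, h⟩
    · rw [ctx_right u h.symm, hidem, h]
    · rw [ctx_right u h.symm, List.append_assoc, ctx_left w hidem, h]
  obtain ⟨r, hr⟩ : ∃ r, ctxOf X (v ++ r) = ctxOf X u := by
    rcases hR.2 with h | ⟨w, -, h⟩
    · exact ⟨u, by rw [hvu, h]⟩
    · exact ⟨w, h⟩
  obtain ⟨l, hl⟩ : ∃ l, ctxOf X (l ++ v) = ctxOf X u := by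
    rcases hL.2 with h | ⟨w, -, h⟩
    · exact ⟨u, by rw [huv, h]⟩
    · exact ⟨w, h⟩
  by_cases hmem : v ∈ langOf X
  swap
  · have hv0 : ctxOf X v = ∅ := by
      ext ⟨p, q⟩
      simp only [Set.mem_empty_iff_false, iff_false]
      exact fun h => hmem (lang_factor h hv)
    rw [hv0, ← hr]
    ext ⟨p, q⟩
    simp only [Set.mem_empty_iff_false, iff_false]
    intro h
    refine hmem (lang_factor (p := p) (q := r ++ q) ?_ hv)
    simpa [ctxOf] using h
  have humem : u ∈ langOf X := by
    have : (([] : List A), ([] : List A)) ∈ ctxOf X v := by simpa [ctxOf] using hmem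
    rw [← huv] at this
    exact lang_factor (p := []) (q := v) (by simpa [ctxOf] using this) hu
  have HR : ∀ b c : List A, (b = u ∨ b = v) → (c = u ∨ c = v) →
      ∃ t, ctxOf X (b ++ c ++ t) = ctxOf X b := by
    rintro b c hb (hc | hc)
    · refine ⟨[], ?_⟩
      rcases hb with hb | hb <;> rw [hb, hc, List.append_nil] <;> assumption
    · refine ⟨r, ?_⟩
      rw [hc, List.append_assoc, ctx_left b hr]
      rcases hb with hb | hb <;> rw [hb] <;> assumption
  have HL : ∀ b c : List A, (b = u ∨ b = v) → (c = u ∨ c = v) →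
      ∃ t, ctxOf X (t ++ c ++ b) = ctxOf X b := by
    rintro b c hb (hc | hc)
    · refine ⟨[], ?_⟩
      rcases hb with hb | hb <;> rw [hb, hc, List.nil_append] <;> assumption
    · refine ⟨l, ?_⟩
      rw [hc, ctx_right b hl]
      rcases hb with hb | hb <;> rw [hb] <;> assumption
  have a : A := u.head hu
  have hlu := List.length_pos_iff.2 hu
  set n := 4 * u.length + 2 * v.length with hn
  obtain ⟨H, hH⟩ := hA n (by omega)
  have hxv : seqOf a u v ∈ An X n :=
    seqOf_An X hshift hclosed a u v hu hmem n (by omega) huv hvu HR HL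
  have hxu : seqOf a u u ∈ An X n := by
    refine seqOf_An X hshift hclosed a u u hu humem n (by omega) hidem hidem ?_ ?_
    · intro b c hb hc
      exact HR b c (.inl (or_self_iff.1 hb)) (.inl (or_self_iff.1 hc))
    · intro b c hb hc
      exact HL b c (.inl (or_self_iff.1 hb)) (.inl (or_self_iff.1 hc))
  have hlv := List.length_pos_iff.2 hv
  have mv : wpow u H ++ v ++ wpow u H ∈ langOf (An X n) := by
    rw [← seqOf_mid a]; exact wordAt_mem hxv _ _ (by omega)
  have mu : wpow u H ++ u ++ wpow u H ∈ langOf (An X n) := by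
    rw [← seqOf_mid a]; exact wordAt_mem hxu _ _ (by omega)
  have cv : ctxOf X (wpow u H ++ v ++ wpow u H) = ctxOf X v := by
    rw [ctx_right _ (ctx_wpow_left huv H), ctx_wpow_right hvu]
  have cu : ctxOf X (wpow u H ++ u ++ wpow u H) = ctxOf X u := by
    rw [ctx_right _ (ctx_wpow_left hidem H), ctx_wpow_right hidem]
  have hlen : H ≤ (wpow u H).length := by
    rw [wpow_length]; exact Nat.le_mul_of_pos_right _ hlu
  obtain ⟨p, p', hp, hpl⟩ : ∃ p p', wpow u H = p ++ p' ∧ p.length = H :=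
    ⟨_, _, (List.take_append_drop H _).symm, by simp [hlen]⟩
  obtain ⟨q', q, hq, hql⟩ : ∃ q' q, wpow u H = q' ++ q ∧ q.length = H :=
    ⟨_, _, (List.take_append_drop ((wpow u H).length - H) _).symm, by simp; omega⟩
  have e : ∀ m : List A, wpow u H ++ m ++ wpow u H = p ++ (p' ++ m ++ q') ++ q := by
    intro m
    conv_lhs => rw [show wpow u H ++ m ++ wpow u H = (p ++ p') ++ m ++ (q' ++ q) by
      rw [← hp, ← hq]]
    simp
  rw [e] at mv mu cv cu
  rw [← cu, ← cv]
  exact hH _ _ _ _ hpl hql mu mv
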